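/- arXiv:2503.14073 — 2 statements merged into one kernel-verified Lean document; each statement's English description precedes it below -/
import Mathlib

section
/- For even k, the determinant of the k×k matrix A (with A having 1's on the diagonal in rows 1 to k/2, entries 1-b on the diagonal in rows k/2+1 to k, entries -b in position (i,j) whenever i+j ≥ k+1, and 0 elsewhere) equals ∑_{i=0}^{k} (-1)^{⌊(i+1)/2⌋} · C(⌊(k-i)/2⌋ + i, i) · b^i, as a polynomial identity in b. -/
/-- The k×k matrix with `A_{i,j} = δ_{i,j} - b·[i+j ≥ k+1]` (1-based indices). -/
def connMatrix (k : ℕ) {R : Type*} [CommRing R] (b : R) : Matrix (Fin k) (Fin k) R :=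
  fun i j => (if i = j then 1 else 0) - (if (i.val + 1) + (j.val + 1) ≥ k + 1 then b else 0)

open Finset Matrix

section Determinants

variable {R : Type*} [CommRing R]

/-- Schur complement of a unit entry in the top left corner. -/
theorem det_eq_det_schur_of_zero_zero_eq_one {n : ℕ} (M : Matrix (Fin (n + 1)) (Fin (n + 1)) R)
    (h : M 0 0 = 1) :
    M.det = (Matrix.of fun i j : Fin n => M i.succ j.succ - M i.succ 0 * M 0 j.succ).det := by
  have key : M.det = (Matrix.of fun i j : Fin (n + 1) =>
      M i j - (Fin.cons 0 (fun i' : Fin n => M i'.succ 0) : Fin (n + 1) → R) i * M 0 j).det := by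
    refine Matrix.det_eq_of_forall_row_eq_smul_add_const
      (Fin.cons 0 (fun i' : Fin n => M i'.succ 0)) 0 (by simp) ?_
    intro i j
    simp
  rw [key, Matrix.det_succ_column_zero, Fin.sum_univ_succ]
  simp [h]
  rfl

/-- Three-term expansion of a determinant whose last row and column are tridiagonal. -/
theorem det_eq_of_tridiagonal_last {n : ℕ} (M : Matrix (Fin (n + 2)) (Fin (n + 2)) R)
    (hrow : ∀ j : Fin n, M (Fin.last _) j.castSucc.castSucc = 0)
    (hcol : ∀ i : Fin n, M i.castSucc.castSucc (Fin.last _) = 0) :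
    M.det = M (Fin.last _) (Fin.last _) * (M.submatrix Fin.castSucc Fin.castSucc).det
      - M (Fin.last _) (Fin.last n).castSucc * M (Fin.last n).castSucc (Fin.last _) *
        (M.submatrix (fun i : Fin n => i.castSucc.castSucc)
          (fun i : Fin n => i.castSucc.castSucc)).det := by
  have hminor : (M.submatrix Fin.castSucc ((Fin.last n).castSucc.succAbove)).det =
      M (Fin.last n).castSucc (Fin.last _) *
        (M.submatrix (fun i : Fin n => i.castSucc.castSucc)
          (fun i : Fin n => i.castSucc.castSucc)).det := by
    rw [Matrix.det_succ_column _ (Fin.last n), Fin.sum_univ_castSucc]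
    have h1 : (Fin.last n).castSucc.succAbove (Fin.last n) = Fin.last (n + 1) := by
      ext; simp [Fin.succAbove]
    have h2 : ∀ j : Fin n, (Fin.last n).castSucc.succAbove j.castSucc = j.castSucc.castSucc := by
      intro j; ext; simp [Fin.succAbove, Fin.lt_def]
    simp only [Matrix.submatrix_apply, h1, hcol, Matrix.submatrix_submatrix, Fin.succAbove_last]
    simp only [Function.comp_def, h2]
    simp [← two_mul]
  rw [Matrix.det_succ_row _ (Fin.last (n + 1)), Fin.sum_univ_castSucc, Fin.sum_univ_castSucc]
  simp only [hrow, Fin.succAbove_last, hminor]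
  simp [← two_mul, ← mul_assoc]
  ring

variable (b : R)

theorem connMatrix_apply (k : ℕ) (i j : Fin k) :
    connMatrix k b i j =
      (if i.val = j.val then 1 else 0) - (if k ≤ i.val + j.val + 1 then b else 0) := by
  simp only [connMatrix, Fin.ext_iff]
  congr 2
  grind

/-- The second difference of the border of `connMatrix` gives a three-term recurrence. -/
theorem det_connMatrix_add_four (n : ℕ) :
    (connMatrix (n + 4) b).det =
      (2 - b ^ 2) * (connMatrix (n + 2) b).det - (connMatrix n b).det := by
  rw [det_eq_det_schur_of_zero_zero_eq_one _ (by simp [connMatrix])]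
  set S : Matrix (Fin (n + 3)) (Fin (n + 3)) R := Matrix.of fun i j =>
    connMatrix (n + 4) b i.succ j.succ -
      connMatrix (n + 4) b i.succ 0 * connMatrix (n + 4) b 0 j.succ with hS
  have hentry : ∀ i j, S i j = (if i.val = j.val then 1 else 0)
      - (if n + 1 ≤ i.val + j.val then b else 0)
      - (if i.val = n + 2 ∧ j.val = n + 2 then b ^ 2 else 0) := by
    intro i j
    have hi := i.isLt
    have hj := j.isLt
    simp only [hS, connMatrix_apply, Matrix.of_apply, Fin.val_succ, Fin.val_zero]
    grind
  set e : Fin (n + 3) → R := fun i => if i.val = n + 2 then -1 else 0 with he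
  set p : Fin (n + 3) := ⟨n + 1, by omega⟩ with hp
  set T : Matrix (Fin (n + 3)) (Fin (n + 3)) R := Matrix.of fun i j => S i j + e i * S p j with hT
  set U : Matrix (Fin (n + 3)) (Fin (n + 3)) R := Matrix.of fun i j => T i j + e j * T i p with hU
  have hTS : T.det = S.det :=
    Matrix.det_eq_of_forall_row_eq_smul_add_const e p (by simp [he, hp]) fun i j => rfl
  have hUT : U.det = T.det := by
    rw [← Matrix.det_transpose U, ← Matrix.det_transpose T]
    exact Matrix.det_eq_of_forall_row_eq_smul_add_const e p (by simp [he, hp]) fun i j => rfl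
  have hUe : ∀ i j, U i j = S i j + e i * S p j + e j * (S i p + e i * S p p) := fun i j => rfl
  have he0 : ∀ i, i.val < n + 2 → e i = 0 := fun i hi => if_neg hi.ne
  have heL : e (Fin.last _) = -1 := if_pos rfl
  have hUS : ∀ i j, i.val < n + 2 → j.val < n + 2 → U i j = S i j := by
    intro i j hi hj
    simp [hUe, he0 i hi, he0 j hj]
  have hUrow : ∀ j, j.val < n + 2 → U (Fin.last _) j = S (Fin.last _) j - S p j := by
    intro j hj
    simp [hUe, he0 j hj, heL, sub_eq_add_neg]
  have hUcol : ∀ i, i.val < n + 2 → U i (Fin.last _) = S i (Fin.last _) - S i p := by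
    intro i hi
    simp [hUe, he0 i hi, heL, sub_eq_add_neg]
  clear_value S T U e
  rw [← hTS, ← hUT, det_eq_of_tridiagonal_last]
  · have hB : U.submatrix Fin.castSucc Fin.castSucc = connMatrix (n + 2) b := by
      ext i j
      rw [Matrix.submatrix_apply, hUS _ _ i.isLt j.isLt, hentry, connMatrix_apply]
      simp only [Fin.val_castSucc]
      grind
    have hE : (U.submatrix (fun i : Fin (n + 1) => i.castSucc.castSucc)
        (fun i : Fin (n + 1) => i.castSucc.castSucc)).det = (connMatrix n b).det := by
      have hV : ∀ i j : Fin (n + 1), U i.castSucc.castSucc j.castSucc.castSucc =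
          (if i.val = j.val then 1 else 0) - (if n + 1 ≤ i.val + j.val then b else 0) := by
        intro i j
        rw [hUS _ _ (by simp; omega) (by simp; omega), hentry]
        simp only [Fin.val_castSucc]
        grind
      rw [det_eq_det_schur_of_zero_zero_eq_one]
      · congr 1
        ext i j
        simp only [Matrix.of_apply, Matrix.submatrix_apply, hV, connMatrix_apply, Fin.val_succ,
          Fin.val_zero]
        grind
      · rw [Matrix.submatrix_apply, hV]
        simp
    have h1 : U (Fin.last _) (Fin.last _) = 2 - b ^ 2 := by
      simp only [hUe, hentry, heL, hp, Fin.val_last]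
      grind
    have h2 : U (Fin.last _) (Fin.last (n + 1)).castSucc = -1 := by
      rw [hUrow _ (by simp)]
      simp [hentry, hp]
      ring
    have h3 : U (Fin.last (n + 1)).castSucc (Fin.last _) = -1 := by
      rw [hUcol _ (by simp)]
      simp [hentry, hp]
      ring
    rw [hB, hE, h1, h2, h3]
    ring
  · intro j
    rw [hUrow _ (by simp; omega), hentry, hentry]
    simp only [hp, Fin.val_castSucc, Fin.val_last]
    grind
  · intro i
    rw [hUcol _ (by simp; omega), hentry, hentry]
    simp only [hp, Fin.val_castSucc, Fin.val_last]
    grind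

theorem det_connMatrix_two : (connMatrix 2 b).det = 1 - b - b ^ 2 := by
  simp [Matrix.det_fin_two, connMatrix]
  ring

theorem det_connMatrix_two_mul {N : ℕ} (p q : ℕ → R) (hp0 : p 0 = 1) (hq0 : q 0 = 0)
    (hp : ∀ m < N, p (m + 1) = p m - b ^ 2 * q (m + 1))
    (hq : ∀ m < N, q (m + 1) = q m + p m) (m : ℕ) (hm : m ≤ N) :
    (connMatrix (2 * m) b).det = p m - b * q m := by
  induction m using Nat.twoStepInduction with
  | zero => simp [hp0, hq0]
  | one =>
    rw [mul_one, det_connMatrix_two, hp 0 hm, hq 0 hm, hp0, hq0]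
    ring
  | more m ih₀ ih₁ =>
    rw [show 2 * (m + 2) = 2 * m + 4 by ring, det_connMatrix_add_four,
      show 2 * m + 2 = 2 * (m + 1) by ring, ih₀ (by omega), ih₁ (by omega),
      hp (m + 1) (by omega), hq (m + 1) (by omega), hp m (by omega), hq m (by omega)]
    ring

end Determinants

theorem sum_range_two_mul_add_one {M : Type*} [AddCommMonoid M] (f : ℕ → M) (m : ℕ) :
    ∑ i ∈ range (2 * m + 1), f i =
      ∑ s ∈ range (m + 1), f (2 * s) + ∑ s ∈ range m, f (2 * s + 1) := by
  induction m with
  | zero => simp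
  | succ m ih =>
    rw [show 2 * (m + 1) + 1 = 2 * m + 1 + 1 + 1 by ring, sum_range_succ, sum_range_succ, ih,
      sum_range_succ (fun s => f (2 * s)) (m + 1), sum_range_succ (fun s => f (2 * s + 1)) m,
      show 2 * (m + 1) = 2 * m + 2 by ring]
    ac_rfl

theorem detA_even (k : ℕ) (hk : 1 ≤ k) (hke : Even k) {R : Type*} [CommRing R] (b : R) :
    (connMatrix k b).det
      = ∑ i ∈ Finset.range (k + 1),
          (-1 : R) ^ ((i + 1) / 2) * ((((k - i) / 2 + i).choose i : ℕ) : R) * b ^ i := by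
  obtain ⟨N, rfl⟩ := hke.two_dvd
  rw [det_connMatrix_two_mul b (N := N)
    (fun m => ∑ s ∈ range (N + 1), (-1 : R) ^ s * ((m + s).choose (2 * s) : R) * (b ^ 2) ^ s)
    (fun m => ∑ s ∈ range N, (-1 : R) ^ s * ((m + s).choose (2 * s + 1) : R) * (b ^ 2) ^ s)
    ?_ ?_ ?_ ?_ N le_rfl]
  · rw [sum_range_two_mul_add_one, sub_eq_add_neg, mul_sum, ← sum_neg_distrib]
    congr 1
    · refine sum_congr rfl fun s hs => ?_
      have := mem_range.1 hs
      rw [show (2 * s + 1) / 2 = s by omega, show (2 * N - 2 * s) / 2 + 2 * s = N + s by omega,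
        pow_mul]
    · refine sum_congr rfl fun s hs => ?_
      have := mem_range.1 hs
      rw [show (2 * s + 1 + 1) / 2 = s + 1 by omega,
        show (2 * N - (2 * s + 1)) / 2 + (2 * s + 1) = N + s by omega]
      ring
  · simp only [sum_range_succ', zero_add]
    rw [sum_eq_zero]
    · simp
    · intro s _
      rw [Nat.choose_eq_zero_of_lt (by omega)]
      simp
  · refine sum_eq_zero fun s _ => ?_
    rw [Nat.choose_eq_zero_of_lt (by omega)]
    simp
  · intro m _
    simp only [sum_range_succ' _ N, mul_sum]
    rw [add_sub_right_comm, ← sum_sub_distrib]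
    congr 1
    · refine sum_congr rfl fun s _ => ?_
      rw [show m + 1 + (s + 1) = m + s + 1 + 1 by ring, show 2 * (s + 1) = 2 * s + 1 + 1 by ring,
        Nat.choose_succ_succ (m + s + 1), show m + (s + 1) = m + s + 1 by ring,
        show m + 1 + s = m + s + 1 by ring]
      push_cast
      ring
    · simp
  · intro m hm
    rw [sum_range_succ _ N, Nat.choose_eq_zero_of_lt (show m + N < 2 * N by omega)]
    simp only [Nat.cast_zero, mul_zero, zero_mul, add_zero]
    rw [← sum_add_distrib]
    refine sum_congr rfl fun s _ => ?_
    rw [show m + 1 + s = m + s + 1 by ring, Nat.choose_succ_succ]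
    push_cast
    ring
end

section
/- For odd k, the determinant of the k×k matrix A defined by A_{i,j} = δ_{i,j} - b·[i+j ≥ k+1] equals ∑_{i=0}^{k} (-1)^{⌊(i+1)/2⌋} · C(⌊(k-i)/2⌋ + i, i) · b^i, as a polynomial identity in b. -/
open Matrix Polynomial

section Matrix

variable {R : Type*} [CommRing R]

/-- The vector `(x, z, y)`. -/
def border {n : ℕ} (x : R) (z : Fin n → R) (y : R) : Fin (n + 2) → R :=
  Fin.cons x (Fin.snoc z y : Fin (n + 1) → R)

lemma sum_border {n : ℕ} (x : R) (z : Fin n → R) (y : R) :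
    ∑ i, border x z y i = x + ((∑ i, z i) + y) := by
  simp [border, Fin.sum_univ_succ (n := n + 1), Fin.sum_univ_castSucc (n := n)]

lemma connMatrix_succ_succ (n : ℕ) (b : R) (i j : Fin n) :
    connMatrix (n + 2) b i.castSucc.succ j.castSucc.succ = connMatrix n b i j := by
  have h : n + 2 + 1 ≤ i.val + 1 + 1 + (j.val + 1 + 1) ↔ n + 1 ≤ i.val + 1 + (j.val + 1) := by
    omega
  simp [connMatrix, h]

lemma connMatrix_mulVec_border (n : ℕ) (b x y : R) (z : Fin n → R) :
    connMatrix (n + 2) b *ᵥ border x z y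
      = border (x - b * y) (fun i => (connMatrix n b *ᵥ z) i - b * y)
          (-b * x - b * (∑ i, z i) + (1 - b) * y) := by
  funext i
  rw [mulVec, dotProduct, Fin.sum_univ_succ, Fin.sum_univ_castSucc]
  refine Fin.cases ?_ (fun i => ?_) i
  · have h (j : Fin n) : connMatrix (n + 2) b 0 j.castSucc.succ = 0 := by
      have := j.isLt
      simp [connMatrix, Fin.ext_iff]
      omega
    simp only [h]
    simp [border, connMatrix, Fin.ext_iff]
    ring
  · refine Fin.lastCases ?_ (fun i => ?_) i
    · have h (j : Fin n) : connMatrix (n + 2) b (Fin.last n).succ j.castSucc.succ = -b := by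
        have := j.isLt
        have h1 : n + 2 + 1 ≤ n + 1 + 1 + (j.val + 1 + 1) := by omega
        have h2 : n ≠ j.val := by omega
        simp [connMatrix, Fin.ext_iff, h1, h2]
      have h0 : connMatrix (n + 2) b (Fin.last n).succ 0 = -b := by
        simp [connMatrix, Fin.ext_iff]
      have hl : connMatrix (n + 2) b (Fin.last n).succ (Fin.last n).succ = 1 - b := by
        simp [connMatrix]
      simp only [h, h0, hl]
      simp [border, ← Finset.mul_sum]
      ring
    · have hi := i.isLt
      have h0 : connMatrix (n + 2) b i.castSucc.succ 0 = 0 := by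
        simp [connMatrix, Fin.ext_iff]
      have hl : connMatrix (n + 2) b i.castSucc.succ (Fin.last n).succ = -b := by
        have h1 : n + 2 + 1 ≤ i.val + 1 + 1 + (n + 1 + 1) := by omega
        have h2 : i.val ≠ n := by omega
        simp [connMatrix, Fin.ext_iff, h1, h2]
      simp only [connMatrix_succ_succ, h0, hl]
      simp [border, mulVec, dotProduct]
      ring

lemma adjugate_connMatrix_last (n : ℕ) (b : R) :
    (connMatrix (n + 2) b).adjugate (Fin.last _) (Fin.last _) = (connMatrix n b).det := by
  rw [adjugate_fin_succ_eq_det_submatrix, det_succ_row_zero, Fin.sum_univ_succ,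
    Finset.sum_eq_zero]
  · have h : (connMatrix (n + 2) b) 0 0 = 1 := by simp [connMatrix]
    have hs : (-1 : R) ^ (n + 1 + (n + 1)) = 1 := Even.neg_one_pow ⟨_, rfl⟩
    simp only [Fin.val_last, hs, submatrix_apply, Fin.succAbove_last, Fin.castSucc_zero,
      submatrix_submatrix, h]
    simp only [Fin.val_zero, pow_zero, one_mul, add_zero]
    congr 1
    ext i j
    rw [← connMatrix_succ_succ]
    simp
  · intro j _
    have h : (connMatrix (n + 2) b) 0 j.succ.castSucc = 0 := by
      have := j.isLt
      simp [connMatrix, Fin.ext_iff]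
      omega
    simp only [submatrix_apply, Fin.succAbove_last, Fin.castSucc_zero, h]
    simp

/-- If `A v = (det A) • 1` for `A = connMatrix n b`, a bordered vector shows how the determinant
changes when `n` grows by two. -/
lemma det_mul_det_connMatrix_add_two (n : ℕ) (b : R) (v : Fin n → R)
    (hv : connMatrix n b *ᵥ v = fun _ => (connMatrix n b).det) :
    (connMatrix n b).det * (connMatrix (n + 2) b).det = (connMatrix n b).det *
      ((1 - b - b ^ 2) * (connMatrix n b).det - b ^ 2 * ∑ i, v i) := by
  set d := (connMatrix n b).det with hd
  have hw : connMatrix (n + 2) b *ᵥ border (b * d) (b • v) d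
      = Pi.single (Fin.last _) ((1 - b - b ^ 2) * d - b ^ 2 * ∑ i, v i) := by
    rw [connMatrix_mulVec_border, mulVec_smul, hv]
    funext i
    refine Fin.cases ?_ (fun i => ?_) i
    · simp [border, Fin.ext_iff]
    · refine Fin.lastCases ?_ (fun i => ?_) i
      · rw [Fin.succ_last, Pi.single_eq_same, ← Fin.succ_last]
        simp [border, ← Finset.mul_sum]
        ring
      · have : i.val ≠ n := i.isLt.ne
        simp [border, Fin.ext_iff, this]
  have h := congrArg (fun u => ((connMatrix (n + 2) b).adjugate *ᵥ u) (Fin.last _)) hw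
  simp only [mulVec_mulVec, adjugate_mul, smul_mulVec, one_mulVec, mulVec_single,
    Pi.smul_apply, col_apply, adjugate_connMatrix_last] at h
  have hl : border (b * d) (b • v) d (Fin.last _) = d := by
    rw [← Fin.succ_last]
    simp [border]
  rw [hl] at h
  simp only [smul_eq_mul, MulOpposite.smul_eq_mul_unop, MulOpposite.unop_op, ← hd] at h
  rw [mul_comm, h]

lemma connMatrix_mulVec_border_const (n : ℕ) (b : R) (v : Fin n → R) (d : R)
    (hv : connMatrix n b *ᵥ v = fun _ => d) :
    connMatrix (n + 2) b *ᵥ border d v ((1 + b) * d + b * ∑ i, v i)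
      = fun _ => (1 - b - b ^ 2) * d - b ^ 2 * ∑ i, v i := by
  rw [connMatrix_mulVec_border, hv]
  funext i
  refine Fin.cases ?_ (fun i => ?_) i
  · simp [border]
    ring
  · refine Fin.lastCases ?_ (fun i => ?_) i <;> simp [border] <;> ring

lemma map_det_connMatrix {S : Type*} [CommRing S] (f : R →+* S) (n : ℕ) (b : R) :
    f (connMatrix n b).det = (connMatrix n (f b)).det := by
  rw [RingHom.map_det]
  congr 1
  ext i j
  simp [connMatrix, apply_ite f]

lemma connMatrix_zero (n : ℕ) : connMatrix n (0 : R) = 1 := by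
  ext i j
  simp [connMatrix, one_apply]

end Matrix

section ClosedForm

variable {R : Type*} [CommRing R]

/-- The sum `∑ (-1)^⌊(i+1)/2⌋ C(⌊(k+i)/2⌋, i) b^i`. -/
def binomSum (k : ℕ) (b : R) : R :=
  ∑ i ∈ Finset.range (k + 1), (-1 : R) ^ ((i + 1) / 2) * (((k + i) / 2).choose i : R) * b ^ i

lemma neg_one_pow_half_succ (i : ℕ) :
    (-1 : R) ^ ((i + 1 + 1) / 2) = -((-1) ^ i * (-1) ^ ((i + 1) / 2)) := by
  obtain ⟨m, rfl | rfl⟩ := i.even_or_odd'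
  · rw [show (2 * m + 1 + 1) / 2 = m + 1 by omega, show (2 * m + 1) / 2 = m by omega]
    simp [pow_succ, pow_mul]
  · rw [show (2 * m + 1 + 1 + 1) / 2 = m + 1 by omega, show (2 * m + 1 + 1) / 2 = m + 1 by omega]
    simp [pow_succ, pow_mul]

lemma binomSum_add_two (k : ℕ) (b : R) :
    binomSum (k + 2) b = binomSum k b - b * binomSum (k + 1) (-b) := by
  have hk : binomSum k b = ∑ i ∈ Finset.range (k + 3),
      (-1 : R) ^ ((i + 1) / 2) * (((k + i) / 2).choose i : R) * b ^ i := by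
    rw [Finset.sum_range_succ, Finset.sum_range_succ, Nat.choose_eq_zero_of_lt (by omega),
      Nat.choose_eq_zero_of_lt (by omega)]
    simp [binomSum]
  rw [hk, binomSum, binomSum, Finset.sum_range_succ', Finset.sum_range_succ' _ (k + 2),
    Finset.mul_sum, add_sub_right_comm, ← Finset.sum_sub_distrib]
  congr 1
  · refine Finset.sum_congr rfl fun i _ => ?_
    rw [show (k + 2 + (i + 1)) / 2 = (k + 1 + i) / 2 + 1 by omega, Nat.choose_succ_succ,
      show (k + (i + 1)) / 2 = (k + 1 + i) / 2 by congr 1; omega, neg_one_pow_half_succ,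
      neg_pow b]
    push_cast
    ring
  · simp

lemma exists_mulVec_eq_det (m : ℕ) :
    ∃ v : Fin (2 * m + 1) → ℤ[X],
      (connMatrix (2 * m + 1) X *ᵥ v = fun _ => (connMatrix (2 * m + 1) X).det) ∧
      (connMatrix (2 * m + 1) (X : ℤ[X])).det = binomSum (2 * m + 1) X ∧
      binomSum (2 * m) (-X) = (connMatrix (2 * m + 1) X).det + X * ∑ i, v i := by
  induction m with
  | zero =>
    refine ⟨fun _ => 1, ?_, ?_, ?_⟩
    · funext i
      fin_cases i
      simp [mulVec, dotProduct]
    · simp [connMatrix, binomSum, Finset.sum_range_succ, sub_eq_add_neg]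
    · simp [connMatrix, binomSum]
  | succ m ih =>
    obtain ⟨v, hv, hd, he⟩ := ih
    have hne : (connMatrix (2 * m + 1) (X : ℤ[X])).det ≠ 0 := by
      intro h
      have := map_det_connMatrix (evalRingHom (0 : ℤ)) (2 * m + 1) X
      simp [h, connMatrix_zero] at this
    have hdet := mul_left_cancel₀ hne (det_mul_det_connMatrix_add_two _ _ v hv)
    have h1 : binomSum (2 * m + 2) (-X : ℤ[X])
        = binomSum (2 * m) (-X) + X * binomSum (2 * m + 1) X := by
      simp [binomSum_add_two]
    refine ⟨border _ v _, (connMatrix_mulVec_border_const _ _ v _ hv).trans ?_, ?_, ?_⟩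
    · exact funext fun _ => hdet.symm
    · refine hdet.trans ?_
      rw [show 2 * (m + 1) + 1 = 2 * m + 1 + 2 by ring, binomSum_add_two, h1, he, ← hd]
      ring
    · refine h1.trans (Eq.trans ?_ (congrArg₂ (· + X * ·) hdet (sum_border _ v _)).symm)
      rw [he, ← hd]
      ring

end ClosedForm

theorem detA_odd (k : ℕ) (hk : 1 ≤ k) (hko : Odd k) {R : Type*} [CommRing R] (b : R) :
    (connMatrix k b).det
      = ∑ i ∈ Finset.range (k + 1),
          (-1 : R) ^ ((i + 1) / 2) * ((((k - i) / 2 + i).choose i : ℕ) : R) * b ^ i := by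
  obtain ⟨m, rfl⟩ := hko
  obtain ⟨-, -, hd, -⟩ := exists_mulVec_eq_det m
  have h := map_det_connMatrix (eval₂RingHom (Int.castRingHom R) b) (2 * m + 1) X
  rw [hd] at h
  simp only [coe_eval₂RingHom, eval₂_X] at h
  rw [← h, binomSum, eval₂_finsetSum]
  refine Finset.sum_congr rfl fun i hi => ?_
  rw [Finset.mem_range] at hi
  rw [show (2 * m + 1 - i) / 2 + i = (2 * m + 1 + i) / 2 by omega]
  simp [eval₂_mul, eval₂_pow]
end
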